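/- arXiv:2003.06554 — 2 statements merged into one kernel-verified Lean document; each statement's English description precedes it below -/
import Mathlib

section
/- (Theorem 2.1, detailed balance of the splitting Monte Carlo move.) Suppose U = U1 + U2 with U1, U2 even, and suppose the transition density p : ℝ^d × ℝ^d → ℝ of the SDE step satisfies the detailed balance π1(x) p(y, x) = π1(y) p(x, y) for all x, y ∈ ℝ^d (where p and π1 are formed with the fixed points x_j, j ≠ i). Let X = (x_1,…,x_N) ∈ (ℝ^d)^N and let X* be obtained from X by replacing its i-th coordinate x_i with x_i* ∈ ℝ^d. Then exp(−β H(X)) · (1/N) · p(x_i*, x_i) · acc(x_i, x_i*) = exp(−β H(X*)) · (1/N) · p(x_i, x_i*) · acc(x_i*, x_i). -/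
open Finset Real

/-- The N-body energy `H(X) = Σ_ℓ w V(x_ℓ) + Σ_{j<k} w² U(x_j - x_k)`. -/
noncomputable def nBodyEnergy (N d : ℕ) (w : ℝ) (V U : EuclideanSpace ℝ (Fin d) → ℝ)
    (X : Fin N → EuclideanSpace ℝ (Fin d)) : ℝ :=
  ∑ ℓ, w * V (X ℓ) +
    ∑ j, ∑ k ∈ Finset.univ.filter (fun k => j < k), w ^ 2 * U (X j - X k)

/-- The terms of a sum over pairs `j < k` that involve a given index `i`, split off. -/
theorem sum_pairs_eq_sum_erase_add {ι M : Type*} [Fintype ι] [LinearOrder ι] [AddCommMonoid M]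
    (g : ι → ι → M) (hg : ∀ j k, g j k = g k j) (i : ι) :
    ∑ j, ∑ k ∈ univ.filter (fun k => j < k), g j k =
      ∑ j ∈ univ.erase i, g i j +
        ∑ j ∈ univ.erase i, ∑ k ∈ univ.erase i, if j < k then g j k else 0 := by
  simp only [sum_filter]
  have hrow (j : ι) : ∑ k, (if j < k then g j k else 0) =
      (if j < i then g j i else 0) + ∑ k ∈ univ.erase i, if j < k then g j k else 0 :=
    (add_sum_erase _ _ (mem_univ i)).symm
  rw [← add_sum_erase _ _ (mem_univ i), hrow i, if_neg (lt_irrefl i), zero_add,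
    sum_congr rfl fun j _ => hrow j, sum_add_distrib, ← add_assoc, ← sum_add_distrib]
  congr 1
  refine sum_congr rfl fun j hj => ?_
  rcases lt_or_gt_of_ne (ne_of_mem_erase hj) with h | h
  · rw [if_neg h.not_gt, if_pos h, zero_add, hg]
  · rw [if_pos h, if_neg h.not_gt, add_zero]

/-- The part of the `N`-body energy that does not involve the `i`-th particle. -/
noncomputable def restEnergy (N d : ℕ) (w : ℝ) (V U : EuclideanSpace ℝ (Fin d) → ℝ)
    (i : Fin N) (X : Fin N → EuclideanSpace ℝ (Fin d)) : ℝ :=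
  ∑ j ∈ univ.erase i, w * V (X j) +
    ∑ j ∈ univ.erase i, ∑ k ∈ univ.erase i, if j < k then w ^ 2 * U (X j - X k) else 0

theorem nBodyEnergy_eq_add_restEnergy (N d : ℕ) (w : ℝ) {V U : EuclideanSpace ℝ (Fin d) → ℝ}
    (hU : ∀ x, U (-x) = U x) (i : Fin N) (X : Fin N → EuclideanSpace ℝ (Fin d)) :
    nBodyEnergy N d w V U X =
      w * V (X i) + w ^ 2 * ∑ j ∈ univ.erase i, U (X i - X j) + restEnergy N d w V U i X := by
  have hsymm (j k : Fin N) : w ^ 2 * U (X j - X k) = w ^ 2 * U (X k - X j) := by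
    rw [← hU, neg_sub]
  rw [nBodyEnergy, restEnergy, sum_pairs_eq_sum_erase_add _ hsymm i,
    ← add_sum_erase _ _ (mem_univ i), mul_sum]
  ring

theorem restEnergy_update (N d : ℕ) (w : ℝ) (V U : EuclideanSpace ℝ (Fin d) → ℝ)
    (i : Fin N) (X : Fin N → EuclideanSpace ℝ (Fin d)) (z : EuclideanSpace ℝ (Fin d)) :
    restEnergy N d w V U i (Function.update X i z) = restEnergy N d w V U i X := by
  have h (j : Fin N) (hj : j ∈ univ.erase i) : Function.update X i z j = X j :=
    Function.update_of_ne (ne_of_mem_erase hj) _ _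
  unfold restEnergy
  congr 1
  · exact sum_congr rfl fun j hj => by rw [h j hj]
  · exact sum_congr rfl fun j hj => sum_congr rfl fun k hk => by rw [h j hj, h k hk]

/-- Detailed balance of the Metropolis acceptance probability with respect to `exp (-β a)`. -/
theorem exp_mul_min_one_exp_symm (β a b : ℝ) :
    exp (-β * a) * min 1 (exp (-β * (b - a))) = exp (-β * b) * min 1 (exp (-β * (a - b))) := by
  rw [mul_min_of_nonneg _ _ (exp_pos _).le, mul_min_of_nonneg _ _ (exp_pos _).le,
    ← exp_add, ← exp_add, min_comm]
  ring_nf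

/-- Theorem 2.1, detailed balance of the splitting Monte Carlo move:
if `U = U1 + U2` with `U1, U2` even and the transition density `p` of the SDE step
satisfies the detailed balance `π1(x) p(y,x) = π1(y) p(x,y)` (π1 formed with the
fixed points `x_j`, `j ≠ i`), then for `X* = X` with the i-th coordinate replaced
by `x_i*`:
`exp(-βH(X)) (1/N) p(x_i*, x_i) acc(x_i, x_i*)
  = exp(-βH(X*)) (1/N) p(x_i, x_i*) acc(x_i*, x_i)`. -/
theorem stmt_2 (N d : ℕ) (hN : 2 ≤ N) (hd : 1 ≤ d) (i : Fin N) (β w : ℝ)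
    (hβ : 0 < β) (hw : 0 < w) (V U1 U2 U : EuclideanSpace ℝ (Fin d) → ℝ)
    (hsplit : ∀ x, U x = U1 x + U2 x)
    (heven1 : ∀ x, U1 (-x) = U1 x) (heven2 : ∀ x, U2 (-x) = U2 x)
    (X : Fin N → EuclideanSpace ℝ (Fin d))
    (p : EuclideanSpace ℝ (Fin d) → EuclideanSpace ℝ (Fin d) → ℝ)
    (hdb : ∀ x y : EuclideanSpace ℝ (Fin d),
      Real.exp (-β * (w * V x + w ^ 2 * ∑ j ∈ Finset.univ.erase i, U1 (x - X j))) *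
          p y x =
        Real.exp (-β * (w * V y + w ^ 2 * ∑ j ∈ Finset.univ.erase i, U1 (y - X j))) *
          p x y)
    (xstar : EuclideanSpace ℝ (Fin d)) :
    Real.exp (-β * nBodyEnergy N d w V U X) * (1 / N) * p xstar (X i) *
        min 1 (Real.exp (-β * ∑ j ∈ Finset.univ.erase i,
          w ^ 2 * (U2 (xstar - X j) - U2 (X i - X j)))) =
      Real.exp (-β * nBodyEnergy N d w V U (Function.update X i xstar)) * (1 / N) *
        p (X i) xstar *
        min 1 (Real.exp (-β * ∑ j ∈ Finset.univ.erase i,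
          w ^ 2 * (U2 (X i - X j) - U2 (xstar - X j)))) := by
  have hU : ∀ x, U (-x) = U x := fun x => by simp only [hsplit, heven1, heven2]
  have hsum (z : EuclideanSpace ℝ (Fin d)) : ∑ j ∈ univ.erase i, U (z - X j) =
      ∑ j ∈ univ.erase i, U1 (z - X j) + ∑ j ∈ univ.erase i, U2 (z - X j) := by
    simp only [hsplit, sum_add_distrib]
  have hupdate : ∑ j ∈ univ.erase i, U (xstar - Function.update X i xstar j) =
      ∑ j ∈ univ.erase i, U (xstar - X j) :=
    sum_congr rfl fun j hj => by rw [Function.update_of_ne (ne_of_mem_erase hj)]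
  rw [nBodyEnergy_eq_add_restEnergy N d w hU i X,
    nBodyEnergy_eq_add_restEnergy N d w hU i (Function.update X i xstar),
    restEnergy_update, Function.update_self, hupdate, hsum, hsum]
  simp only [← mul_sum, sum_sub_distrib, mul_sub (w ^ 2)]
  have hacc := exp_mul_min_one_exp_symm β (w ^ 2 * ∑ j ∈ univ.erase i, U2 (X i - X j))
    (w ^ 2 * ∑ j ∈ univ.erase i, U2 (xstar - X j))
  have hexp (v a b r : ℝ) : exp (-β * (v + w ^ 2 * (a + b) + r)) =
      exp (-β * (v + w ^ 2 * a)) * exp (-β * (w ^ 2 * b)) * exp (-β * r) := by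
    rw [← exp_add, ← exp_add]
    ring_nf
  rw [hexp, hexp]
  set R := exp (-β * restEnergy N d w V U i X)
  linear_combination
    (exp (-β * (w ^ 2 * ∑ j ∈ univ.erase i, U2 (X i - X j))) *
      min 1 (exp (-β * (w ^ 2 * ∑ j ∈ univ.erase i, U2 (xstar - X j) -
        w ^ 2 * ∑ j ∈ univ.erase i, U2 (X i - X j)))) * R * (1 / N)) * hdb (X i) xstar +
    (exp (-β * (w * V xstar + w ^ 2 * ∑ j ∈ univ.erase i, U1 (xstar - X j))) *
      p (X i) xstar * R * (1 / N)) * hacc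
end

section
/- (Stationarity of the semicircle law for the Dyson mean-field equation.) Let ρ(y) = (1/π)√(2 − y²) for |y| ≤ √2 be the semicircle density. Then for every x with |x| < √2, the principal value Hilbert-transform velocity field satisfies u(x) = p.v. ∫_{−√2}^{√2} ρ(y)/(x − y) dy = x; explicitly, lim_{ε→0+} ∫_{[−√2,√2] \ (x−ε, x+ε)} (1/π)√(2 − y²)/(x − y) dy = x. Consequently u(x) − x = 0, so ρ is a stationary solution of the limiting equation ∂_t ρ + ∂_x(ρ(u − x)) = 0. -/
open MeasureTheory Filter

/-- The part of an antiderivative of `y ↦ √(2 - y²) / (x - y)` that is continuous at `x`. -/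
noncomputable def semicircleRegularPrimitive (x y : ℝ) : ℝ :=
  x * Real.arcsin (y / √2) - √(2 - y ^ 2) +
    √(2 - x ^ 2) * Real.log (2 - x * y + √(2 - x ^ 2) * √(2 - y ^ 2))

/-- An antiderivative of `y ↦ √(2 - y²) / (x - y)` away from `x`. -/
noncomputable def semicirclePrimitive (x y : ℝ) : ℝ :=
  semicircleRegularPrimitive x y - √(2 - x ^ 2) * Real.log (x - y)

lemma two_sub_mul_pos {x y : ℝ} (hx : |x| < √2) (hy : |y| ≤ √2) : 0 < 2 - x * y := by
  have h2 : √2 * √2 = 2 := Real.mul_self_sqrt (by norm_num)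
  have h : |x| * |y| < √2 * √2 :=
    (mul_le_mul_of_nonneg_left hy (abs_nonneg x)).trans_lt
      (mul_lt_mul_of_pos_right hx (by positivity))
  have := le_abs_self (x * y)
  rw [abs_mul] at this
  linarith

lemma continuousOn_semicircleRegularPrimitive {x : ℝ} (hx : |x| < √2) :
    ContinuousOn (semicircleRegularPrimitive x) (Set.Icc (-√2) √2) := by
  unfold semicircleRegularPrimitive
  refine ContinuousOn.add ?_ (continuousOn_const.mul (ContinuousOn.log ?_ ?_))
  · exact ((continuous_const.mul (Real.continuous_arcsin.comp (continuous_id.div_const _))).sub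
      (by fun_prop)).continuousOn
  · fun_prop
  · intro y hy
    have := two_sub_mul_pos hx (abs_le.2 hy)
    positivity

lemma continuousOn_semicirclePrimitive {x : ℝ} (hx : |x| < √2) {s : Set ℝ}
    (hs : s ⊆ Set.Icc (-√2) √2) (hxs : x ∉ s) : ContinuousOn (semicirclePrimitive x) s := by
  refine ((continuousOn_semicircleRegularPrimitive hx).mono hs).sub
    (continuousOn_const.mul (ContinuousOn.log (by fun_prop) ?_))
  intro y hy h
  exact hxs (by rwa [sub_eq_zero.1 h])

lemma hasDerivAt_semicirclePrimitive {x y : ℝ} (hx : |x| < √2) (hy : |y| < √2) (hxy : x ≠ y) :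
    HasDerivAt (semicirclePrimitive x) (√(2 - y ^ 2) / (x - y)) y := by
  have h2 : √2 ^ 2 = 2 := Real.sq_sqrt (by norm_num)
  have hs : 0 < √2 := by positivity
  have hx2 : 0 < 2 - x ^ 2 := by
    have := sq_lt_sq' (abs_lt.1 hx).1 (abs_lt.1 hx).2
    linarith
  have hy2 : 0 < 2 - y ^ 2 := by
    have := sq_lt_sq' (abs_lt.1 hy).1 (abs_lt.1 hy).2
    linarith
  have hw : 0 < √(2 - y ^ 2) := Real.sqrt_pos.2 hy2
  have hw2 : √(2 - y ^ 2) ^ 2 = 2 - y ^ 2 := Real.sq_sqrt hy2.le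
  have ha2 : √(2 - x ^ 2) ^ 2 = 2 - x ^ 2 := Real.sq_sqrt hx2.le
  have hN : 0 < 2 - x * y + √(2 - x ^ 2) * √(2 - y ^ 2) := by
    have := two_sub_mul_pos hx hy.le
    positivity
  have hd : x - y ≠ 0 := sub_ne_zero.2 hxy
  have dsqrt : HasDerivAt (fun y : ℝ => √(2 - y ^ 2)) (-y / √(2 - y ^ 2)) y := by
    refine ((((hasDerivAt_id y).pow 2).const_sub 2).sqrt hy2.ne').congr_deriv ?_
    simp only [id, Pi.pow_apply, Nat.cast_ofNat]
    field_simp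
    ring
  have dasin : HasDerivAt (fun y : ℝ => Real.arcsin (y / √2)) (1 / √(2 - y ^ 2)) y := by
    have hlt := abs_lt.1 hy
    have e : √(1 - (y / √2) ^ 2) = √(2 - y ^ 2) / √2 := by
      rw [← Real.sqrt_div hy2.le]
      congr 1
      rw [div_pow, h2]
      ring
    refine ((Real.hasDerivAt_arcsin (x := y / √2)
      (by rw [Ne, div_eq_iff hs.ne']; linarith [hlt.1])
      (by rw [Ne, div_eq_iff hs.ne']; linarith [hlt.2])).comp y
        ((hasDerivAt_id y).div_const √2)).congr_deriv ?_
    rw [e]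
    field_simp
  have dlogN := ((((hasDerivAt_id y).const_mul x).const_sub 2).add
    (dsqrt.const_mul √(2 - x ^ 2))).log hN.ne'
  have dlog := ((hasDerivAt_id y).const_sub x).log hd
  refine ((((dasin.const_mul x).sub dsqrt).add (dlogN.const_mul √(2 - x ^ 2))).sub
    (dlog.const_mul √(2 - x ^ 2))).congr_deriv ?_
  simp only [id, Pi.add_apply]
  generalize √(2 - y ^ 2) = w at *
  generalize √(2 - x ^ 2) = a at *
  have key : (-(x * 1) + a * (-y / w)) / (2 - x * y + a * w) = a / (w * (x - y)) - 1 / (x - y) := by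
    rw [div_eq_iff hN.ne']
    field_simp
    linear_combination (-w) * ha2 + a * hw2
  rw [key]
  field_simp
  linear_combination ha2 - hw2

lemma integral_semicircle_div_sub {x a b : ℝ} (hx : |x| < √2) (hab : a ≤ b) (ha : -√2 ≤ a)
    (hb : b ≤ √2) (hxs : x ∉ Set.Icc a b) :
    IntegrableOn (fun y => 1 / Real.pi * √(2 - y ^ 2) / (x - y)) (Set.Icc a b) ∧
    ∫ y in Set.Icc a b, 1 / Real.pi * √(2 - y ^ 2) / (x - y) =
      1 / Real.pi * (semicirclePrimitive x b - semicirclePrimitive x a) := by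
  have hne : ∀ y ∈ Set.Icc a b, x - y ≠ 0 := fun y hy h => hxs (by rwa [sub_eq_zero.1 h])
  have hc : ContinuousOn (fun y => √(2 - y ^ 2) / (x - y)) (Set.Icc a b) :=
    ContinuousOn.div (by fun_prop) (by fun_prop) hne
  simp only [mul_div_assoc]
  refine ⟨(continuousOn_const.mul hc).integrableOn_Icc, ?_⟩
  rw [integral_const_mul, integral_Icc_eq_integral_Ioc, ← intervalIntegral.integral_of_le hab]
  congr 1
  refine intervalIntegral.integral_eq_sub_of_hasDerivAt_of_le hab
    (continuousOn_semicirclePrimitive hx (Set.Icc_subset_Icc ha hb) hxs) (fun y hy => ?_)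
    (hc.intervalIntegrable_of_Icc hab)
  refine hasDerivAt_semicirclePrimitive hx (abs_lt.2 ⟨ha.trans_lt hy.1, hy.2.trans_le hb⟩) ?_
  exact sub_ne_zero.1 (hne y (Set.Ioo_subset_Icc_self hy))

lemma semicirclePrimitive_sqrt_two_sub {x : ℝ} (hx : |x| < √2) :
    semicirclePrimitive x √2 - semicirclePrimitive x (-√2) = Real.pi * x := by
  have hs : √2 ≠ 0 := by positivity
  have h2 : √2 ^ 2 = 2 := Real.sq_sqrt (by norm_num)
  obtain ⟨h1, h3⟩ := abs_lt.1 hx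
  have e1 : 2 - x * √2 = √2 * (√2 - x) := by linear_combination -h2
  have e2 : 2 - x * -√2 = √2 * (x + √2) := by linear_combination -h2
  have e3 : Real.log (x - √2) = Real.log (√2 - x) := by rw [← Real.log_neg_eq_log, neg_sub]
  simp only [semicirclePrimitive, semicircleRegularPrimitive, neg_sq, h2, sub_self, Real.sqrt_zero,
    mul_zero, add_zero, neg_div, div_self hs, Real.arcsin_neg, Real.arcsin_one, e3]
  rw [e1, e2, sub_neg_eq_add, Real.log_mul hs (by linarith), Real.log_mul hs (by linarith)]
  ring



/-- stationarity of the semicircle law for the Dyson mean-field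
equation: for the semicircle density `ρ(y) = (1/π)√(2 - y²)` on `[-√2, √2]`
and every `x` with `|x| < √2`, the principal value Hilbert-transform velocity
field satisfies
`lim_{ε→0+} ∫_{[-√2,√2] \ (x-ε,x+ε)} (1/π)√(2 - y²)/(x - y) dy = x`,
hence `u(x) - x = 0` and the semicircle law is a stationary solution of
`∂_t ρ + ∂_x(ρ(u - x)) = 0`. -/
theorem stmt_12 (x : ℝ) (hx : |x| < Real.sqrt 2) :
    Tendsto
      (fun ε : ℝ =>
        ∫ y in Set.Icc (-Real.sqrt 2) (Real.sqrt 2) \ Set.Ioo (x - ε) (x + ε),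
          (1 / Real.pi) * Real.sqrt (2 - y ^ 2) / (x - y))
      (nhdsWithin 0 (Set.Ioi 0)) (nhds x) := by
  have hreg : ContinuousAt (semicircleRegularPrimitive x) x :=
    (continuousOn_semicircleRegularPrimitive hx).continuousAt
      (Icc_mem_nhds (abs_lt.1 hx).1 (abs_lt.1 hx).2)
  obtain ⟨h1, h2⟩ := abs_lt.1 hx
  have hsub : Tendsto (fun ε : ℝ => semicircleRegularPrimitive x (x - ε))
      (nhdsWithin 0 (Set.Ioi 0)) (nhds (semicircleRegularPrimitive x x)) :=
    hreg.tendsto.comp (((continuous_sub_left x).tendsto' 0 x (sub_zero x)).mono_left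
      nhdsWithin_le_nhds)
  have hadd : Tendsto (fun ε : ℝ => semicircleRegularPrimitive x (x + ε))
      (nhdsWithin 0 (Set.Ioi 0)) (nhds (semicircleRegularPrimitive x x)) :=
    hreg.tendsto.comp (((continuous_const_add x).tendsto' 0 x (add_zero x)).mono_left
      nhdsWithin_le_nhds)
  have hlim := ((hsub.sub hadd).const_mul (1 / Real.pi)).const_add x
  rw [sub_self, mul_zero, add_zero] at hlim
  refine hlim.congr' ?_
  filter_upwards [Ioo_mem_nhdsGT (show (0 : ℝ) < min (x + √2) (√2 - x) from
    lt_min (by linarith) (by linarith))] with ε hε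
  obtain ⟨hε0, hε1⟩ := hε
  have hl := hε1.trans_le (min_le_left _ _)
  have hr := hε1.trans_le (min_le_right _ _)
  have hset : Set.Icc (-√2) √2 \ Set.Ioo (x - ε) (x + ε) =
      Set.Icc (-√2) (x - ε) ∪ Set.Icc (x + ε) √2 := by
    ext y
    simp only [Set.mem_sdiff, Set.mem_Icc, Set.mem_Ioo, Set.mem_union, not_and, not_lt]
    constructor
    · rintro ⟨⟨h3, h4⟩, h5⟩
      rcases le_or_gt y (x - ε) with h | h
      · exact Or.inl ⟨h3, h⟩
      · exact Or.inr ⟨h5 h, h4⟩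
    · rintro (⟨h3, h4⟩ | ⟨h3, h4⟩)
      · exact ⟨⟨h3, by linarith⟩, fun h => by linarith⟩
      · exact ⟨⟨by linarith, h4⟩, fun _ => h3⟩
  have hdisj : Disjoint (Set.Icc (-√2) (x - ε)) (Set.Icc (x + ε) √2) :=
    Set.disjoint_left.2 fun y hy hy' => by linarith [hy.2, hy'.1]
  obtain ⟨i1, e1⟩ := integral_semicircle_div_sub (a := -√2) (b := x - ε) hx (by linarith) le_rfl
    (by linarith) (fun h => by linarith [h.2])
  obtain ⟨i2, e2⟩ := integral_semicircle_div_sub (a := x + ε) (b := √2) hx (by linarith)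
    (by linarith) le_rfl (fun h => by linarith [h.1])
  have hlog : Real.log (x - (x + ε)) = Real.log (x - (x - ε)) := by
    rw [← Real.log_neg_eq_log]
    ring_nf
  have hends : x = 1 / Real.pi * (semicirclePrimitive x √2 - semicirclePrimitive x (-√2)) := by
    rw [semicirclePrimitive_sqrt_two_sub hx]
    field_simp
  rw [hset, setIntegral_union hdisj measurableSet_Icc i1 i2, e1, e2]
  have el : semicirclePrimitive x (x - ε) = semicircleRegularPrimitive x (x - ε) -
    √(2 - x ^ 2) * Real.log (x - (x - ε)) := rfl
  have er : semicirclePrimitive x (x + ε) = semicircleRegularPrimitive x (x + ε) -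
    √(2 - x ^ 2) * Real.log (x - (x - ε)) := by rw [← hlog]; rfl
  rw [el, er]
  linear_combination hends
end
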